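/- arXiv:1508.04074 — 2 statements merged into one kernel-verified Lean document; each statement's English description precedes it below -/
import Mathlib

section
/- Let (Ω, μ) be a measure space and T : ℓ₁ → L₁(μ) a positive bounded linear operator which is ε-disjointness preserving, where 0 < ε < ‖T‖/16. Then there exists a positive disjointness preserving linear operator S : ℓ₁ → L₁(μ) such that 0 ≤ S ≤ T and ‖T − S‖ ≤ 2·√(2·ε·‖T‖/3). -/
open MeasureTheory

/-- The second moment of a Rademacher sum, written as a sum over all subsets. -/
lemma sum_powerset_sq_two_mul_sum_sub {ι : Type*} [DecidableEq ι] (s : Finset ι) (h : ι → ℝ) :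
    ∑ A ∈ s.powerset, (2 * ∑ i ∈ A, h i - ∑ i ∈ s, h i) ^ 2 = 2 ^ s.card * ∑ i ∈ s, h i ^ 2 := by
  induction s using Finset.induction_on with
  | empty => simp
  | insert i t hi ih =>
    rw [Finset.sum_powerset_insert hi, ← Finset.sum_add_distrib, Finset.card_insert_of_notMem hi,
      Finset.sum_insert hi, Finset.sum_insert hi]
    have : ∀ A ∈ t.powerset, (2 * ∑ j ∈ A, h j - (h i + ∑ j ∈ t, h j)) ^ 2 +
        (2 * ∑ j ∈ insert i A, h j - (h i + ∑ j ∈ t, h j)) ^ 2 =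
        2 * (2 * ∑ j ∈ A, h j - ∑ j ∈ t, h j) ^ 2 + 2 * h i ^ 2 := by
      intro A hA
      rw [Finset.sum_insert (fun h' => hi (Finset.mem_powerset.1 hA h'))]
      ring
    rw [Finset.sum_congr rfl this, Finset.sum_add_distrib, ← Finset.mul_sum, ih]
    simp [Finset.card_powerset]
    ring

/-- Splitting nonnegative numbers at random into two parts, the smaller part is on average at
least `3/8` of the total mass without the largest number. -/
lemma three_eighths_sum_le_sum_powerset_min {ι : Type*} [DecidableEq ι] (t : Finset ι) (i : ι)
    (hi : i ∉ t) (h : ι → ℝ) (h0 : ∀ j, 0 ≤ h j) (hm : ∀ j ∈ t, h j ≤ h i) :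
    3 / 8 * (2 ^ (insert i t).card * ∑ j ∈ t, h j) ≤
      ∑ A ∈ (insert i t).powerset, min (∑ j ∈ A, h j) (∑ j ∈ insert i t, h j - ∑ j ∈ A, h j) := by
  rcases (h0 i).eq_or_lt with h_zero | h_pos
  · rw [Finset.sum_eq_zero fun j hj => le_antisymm (h_zero ▸ hm j hj) (h0 j)]
    simp only [mul_zero]
    refine Finset.sum_nonneg fun A hA => le_min (Finset.sum_nonneg fun j _ => h0 j) ?_
    exact sub_nonneg.2 (Finset.sum_le_sum_of_subset_of_nonneg (Finset.mem_powerset.1 hA)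
      fun j _ _ => h0 j)
  rw [Finset.sum_powerset_insert hi, ← Finset.sum_add_distrib, Finset.card_insert_of_notMem hi,
      Finset.sum_insert hi]
  refine le_of_mul_le_mul_left ?_ h_pos
  set u := ∑ j ∈ t, h j with hu
  have hsq : ∑ j ∈ t, h j ^ 2 ≤ h i * u := by
    rw [hu, Finset.mul_sum]
    exact Finset.sum_le_sum fun j hj => by nlinarith [hm j hj, h0 j]
  have key : ∀ A ∈ t.powerset, h i * u - (2 * ∑ j ∈ A, h j - u) ^ 2 / 4 ≤
      h i * (min (∑ j ∈ A, h j) (h i + u - ∑ j ∈ A, h j) +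
        min (∑ j ∈ insert i A, h j) (h i + u - ∑ j ∈ insert i A, h j)) := by
    intro A hA
    rw [Finset.sum_insert (fun h' => hi (Finset.mem_powerset.1 hA h'))]
    generalize ∑ j ∈ A, h j = Y
    rcases min_cases Y (h i + u - Y) with ⟨e, _⟩ | ⟨e, _⟩ <;>
    rcases min_cases (h i + Y) (h i + u - (h i + Y)) with ⟨e', _⟩ | ⟨e', _⟩ <;>
    rw [e, e'] <;>
    nlinarith [sq_nonneg (2 * Y - u - 2 * h i), sq_nonneg (2 * Y - u + 2 * h i),
      sq_nonneg (2 * Y - u)]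
  refine le_trans ?_ ((Finset.sum_le_sum key).trans_eq (Finset.mul_sum _ _ _).symm)
  rw [Finset.sum_sub_distrib, ← Finset.sum_div, sum_powerset_sq_two_mul_sum_sub]
  simp only [Finset.sum_const, Finset.card_powerset, nsmul_eq_mul, Nat.cast_pow, Nat.cast_ofNat]
  have : (0 : ℝ) < 2 ^ t.card := by positivity
  rw [pow_succ]
  nlinarith

/-- A fractional allocation of the points of `Ω` to the indices in `ι`. -/
structure IsAllocation {Ω ι : Type*} [MeasurableSpace Ω] [Fintype ι] (φ : ι → Ω → ℝ) : Prop where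
  measurable : ∀ i, Measurable (φ i)
  nonneg : ∀ i ω, 0 ≤ φ i ω
  sum_eq_one : ∀ ω, ∑ i, φ i ω = 1

namespace IsAllocation

variable {Ω ι : Type*} [MeasurableSpace Ω] [Fintype ι] {φ : ι → Ω → ℝ}

lemma le_one (hφ : IsAllocation φ) (i : ι) (ω : Ω) : φ i ω ≤ 1 :=
  hφ.sum_eq_one ω ▸ Finset.single_le_sum (fun j _ => hφ.nonneg j ω) (Finset.mem_univ i)

lemma add_le_one (hφ : IsAllocation φ) {i j : ι} (hij : i ≠ j) (ω : Ω) :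
    φ i ω + φ j ω ≤ 1 := by
  classical
  rw [← hφ.sum_eq_one ω, ← Finset.sum_pair (f := fun i => φ i ω) hij]
  exact Finset.sum_le_sum_of_subset_of_nonneg (Finset.subset_univ _) fun k _ _ => hφ.nonneg k ω

lemma integrable_mul_one_sub (hφ : IsAllocation φ) {μ : Measure Ω} {f : Ω → ℝ}
    (hf : Integrable f μ) (i : ι) : Integrable (fun ω => f ω * (1 - φ i ω)) μ := by
  refine hf.mul_bdd (c := 1) (measurable_const.sub (hφ.measurable i)).aestronglyMeasurable
    (ae_of_all _ fun ω => ?_)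
  rw [Real.norm_of_nonneg (by linarith [hφ.le_one i ω])]
  linarith [hφ.nonneg i ω]

end IsAllocation

/-- Allocating each point to an index where `h` is largest loses at most `8/3` of the average, over
all splittings of the index set, of the smaller part. -/
lemma exists_isAllocation_sum_le {Ω ι : Type*} [MeasurableSpace Ω] [Fintype ι] [LinearOrder ι]
    [Nonempty ι] (h : ι → Ω → ℝ) (hm : ∀ i, Measurable (h i)) (h0 : ∀ i ω, 0 ≤ h i ω) :
    ∃ φ : ι → Ω → ℝ, IsAllocation φ ∧ ∀ ω,
      3 / 8 * (2 ^ Fintype.card ι * ∑ i, h i ω * (1 - φ i ω)) ≤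
        ∑ A : Finset ι, min (∑ i ∈ A, h i ω) (∑ i ∈ Aᶜ, h i ω) := by
  classical
  let S : ι → Set Ω := fun i => {ω | (∀ j, h j ω ≤ h i ω) ∧ ∀ j, j < i → h j ω < h i ω}
  have hS : ∀ i, MeasurableSet (S i) := by
    intro i
    simp only [S, Set.ofPred_and, Set.ofPred_forall]
    exact (MeasurableSet.iInter fun j => measurableSet_le (hm j) (hm i)).inter
      (MeasurableSet.iInter fun j => MeasurableSet.iInter fun _ => measurableSet_lt (hm j) (hm i))
  have hex : ∀ ω, ∃ i, (∀ j, h j ω ≤ h i ω) ∧ ∀ j,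
      (S j).indicator (1 : Ω → ℝ) ω = if j = i then (1 : ℝ) else 0 := by
    intro ω
    obtain ⟨k, -, hk⟩ := Finset.exists_max_image Finset.univ (fun i => h i ω) Finset.univ_nonempty
    have hne : (Finset.univ.filter fun i => ∀ j, h j ω ≤ h i ω).Nonempty :=
      ⟨k, by simpa using hk⟩
    obtain ⟨i, hi, hi_min⟩ := Finset.exists_min_image _ id hne
    simp only [Finset.mem_filter, Finset.mem_univ, true_and, id] at hi hi_min
    have hlt : ∀ j, j < i → h j ω < h i ω := fun j hj => lt_of_not_ge fun hle =>
      hj.not_ge (hi_min j fun l => (hi l).trans hle)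
    refine ⟨i, hi, fun j => ?_⟩
    split_ifs with hji
    · subst hji
      exact Set.indicator_of_mem (show ω ∈ S j from ⟨hi, hlt⟩) _
    · refine Set.indicator_of_notMem (fun hj => ?_) _
      rcases lt_or_gt_of_ne hji with hlt' | hgt
      · exact (hlt j hlt').not_ge (hj.1 i)
      · exact (hj.2 i hgt).not_ge (hi j)
  refine ⟨fun i => (S i).indicator 1, ⟨fun i => measurable_one.indicator (hS i),
    fun i ω => Set.indicator_nonneg (fun _ _ => zero_le_one) ω, fun ω => ?_⟩, fun ω => ?_⟩
  · obtain ⟨i, -, hi⟩ := hex ω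
    simp [hi]
  · obtain ⟨i, himax, hi⟩ := hex ω
    have key := three_eighths_sum_le_sum_powerset_min (Finset.univ.erase i) i (by simp)
      (fun j => h j ω) (fun j => h0 j ω) (fun j _ => himax j)
    rw [Finset.insert_erase (Finset.mem_univ i), Finset.powerset_univ, Finset.card_univ] at key
    convert key using 3
    · simp only [hi]
      rw [← Finset.add_sum_erase _ _ (Finset.mem_univ i), if_pos rfl, sub_self, mul_zero,
        zero_add]
      refine Finset.sum_congr rfl fun j hj => ?_
      rw [if_neg (Finset.ne_of_mem_erase hj), sub_zero, mul_one]
    · rw [eq_sub_iff_add_eq, Finset.sum_compl_add_sum]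

/-- By separation of convex sets, a bound on the smaller part of every splitting of every convex
combination of the `f i` gives an allocation which is simultaneously good for all `i`. -/
lemma exists_isAllocation_integral_lt {Ω ι : Type*} [MeasurableSpace Ω] (μ : Measure Ω)
    [Fintype ι] [LinearOrder ι] [Nonempty ι] {ε : ℝ} (hε : 0 < ε) (f : ι → Ω → ℝ)
    (hm : ∀ i, Measurable (f i)) (h0 : ∀ i ω, 0 ≤ f i ω) (hf : ∀ i, Integrable (f i) μ)
    (hmin : ∀ a : ι → ℝ, (∀ i, 0 ≤ a i) → ∑ i, a i = 1 → ∀ A : Finset ι,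
      ∫ ω, min (∑ i ∈ A, a i * f i ω) (∑ i ∈ Aᶜ, a i * f i ω) ∂μ ≤ ε) :
    ∃ φ : ι → Ω → ℝ, IsAllocation φ ∧ ∀ i, ∫ ω, f i ω * (1 - φ i ω) ∂μ < 3 * ε := by
  classical
  let K : Set (ι → ℝ) := {v | ∃ φ : ι → Ω → ℝ, IsAllocation φ ∧
    ∀ i, v i = ∫ ω, f i ω * (1 - φ i ω) ∂μ}
  let U : Set (ι → ℝ) := Set.univ.pi fun _ => Set.Iio (3 * ε)
  by_cases hdisj : Disjoint U K
  swap
  · obtain ⟨v, hvU, φ, hφ, hv⟩ := Set.not_disjoint_iff.1 hdisj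
    exact ⟨φ, hφ, fun i => hv i ▸ hvU i trivial⟩
  exfalso
  have hUo : IsOpen U := isOpen_set_pi Set.finite_univ fun _ _ => isOpen_Iio
  have hUc : Convex ℝ U := convex_pi fun _ _ => convex_Iio _
  have hKc : Convex ℝ K := by
    rintro v ⟨φ, hφ, hv⟩ w ⟨ψ, hψ, hw⟩ s t hs ht hst
    refine ⟨fun i ω => s * φ i ω + t * ψ i ω,
      ⟨fun i => ((hφ.measurable i).const_mul s).add ((hψ.measurable i).const_mul t),
      fun i ω => add_nonneg (mul_nonneg hs (hφ.nonneg i ω)) (mul_nonneg ht (hψ.nonneg i ω)),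
      fun ω => ?_⟩, fun i => ?_⟩
    · rw [Finset.sum_add_distrib, ← Finset.mul_sum, ← Finset.mul_sum, hφ.sum_eq_one,
        hψ.sum_eq_one, mul_one, mul_one, hst]
    · simp only [Pi.add_apply, Pi.smul_apply, smul_eq_mul, hv, hw]
      rw [← integral_const_mul, ← integral_const_mul,
        ← integral_add ((hφ.integrable_mul_one_sub (hf i) i).const_mul s)
          ((hψ.integrable_mul_one_sub (hf i) i).const_mul t)]
      congr 1 with ω
      linear_combination f i ω * hst
  obtain ⟨l, u, hlU, hlK⟩ := geometric_hahn_banach_open hUc hUo hKc hdisj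
  set w : ι → ℝ := fun i => l (Pi.single i 1) with hw_def
  have hl : ∀ v, l v = ∑ i, v i * w i := by
    intro v
    conv_lhs => rw [pi_eq_sum_univ' v, map_sum]
    refine Finset.sum_congr rfl fun i _ => ?_
    rw [map_smul, smul_eq_mul]
  have hw : ∀ i, 0 ≤ w i := by
    intro i
    by_contra! hi
    have h1 : Pi.single i (|u| / w i) ∈ U := by
      intro j _
      have : |u| / w i ≤ 0 := div_nonpos_of_nonneg_of_nonpos (abs_nonneg u) hi.le
      by_cases hj : j = i
      · subst hj
        simp only [Pi.single_eq_same, Set.mem_Iio]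
        linarith
      · simp only [Pi.single_eq_of_ne hj, Set.mem_Iio]
        linarith
    have h2 := hlU _ h1
    rw [hl, Finset.sum_eq_single i (fun j _ hj => by simp [Pi.single_eq_of_ne hj]) (by simp),
      Pi.single_eq_same, div_mul_cancel₀ _ hi.ne] at h2
    exact (le_abs_self u).not_gt h2
  set W := ∑ i, w i with hW_def
  obtain ⟨φ, hφ, hφ_le⟩ := exists_isAllocation_sum_le (fun i ω => w i / W * f i ω)
    (fun i => (hm i).const_mul _) (fun i ω => mul_nonneg
      (div_nonneg (hw i) (Finset.sum_nonneg fun i _ => hw i)) (h0 i ω))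
  have hK := hlK (fun i => ∫ ω, f i ω * (1 - φ i ω) ∂μ) ⟨φ, hφ, fun i => rfl⟩
  have hU := hlU (fun _ => 8 / 3 * ε) (fun i _ => by simp only [Set.mem_Iio]; linarith)
  rw [hl] at hK hU
  rw [← Finset.mul_sum, ← hW_def] at hU
  rcases (Finset.sum_nonneg fun i _ => hw i : 0 ≤ W).eq_or_lt with hW | hW
  · have hw0 : ∀ i, w i = 0 := fun i =>
      (Finset.sum_eq_zero_iff_of_nonneg fun i _ => hw i).1 hW.symm i (Finset.mem_univ i)
    simp only [hw0, mul_zero, Finset.sum_const_zero] at hK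
    rw [show W = 0 from hW.symm] at hU
    linarith
  have hint : ∀ A : Finset ι, Integrable (fun ω => ∑ i ∈ A, w i / W * f i ω) μ := fun A =>
    integrable_finsetSum _ fun i _ => (hf i).const_mul _
  have hI := integral_mono (μ := μ)
    (((integrable_finsetSum _ fun i _ =>
      hφ.integrable_mul_one_sub ((hf i).const_mul (w i / W)) i).const_mul _).const_mul _)
    (integrable_finsetSum _ fun A _ => (hint A).inf (hint Aᶜ)) hφ_le
  rw [integral_const_mul, integral_const_mul, integral_finsetSum _ fun i _ =>
      hφ.integrable_mul_one_sub ((hf i).const_mul (w i / W)) i,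
    integral_finsetSum _ fun A _ => (hint A).inf (hint Aᶜ)] at hI
  have hle := hI.trans (Finset.sum_le_sum fun A _ => hmin (fun i => w i / W)
    (fun i => div_nonneg (hw i) hW.le) (by rw [← Finset.sum_div, div_self hW.ne']) A)
  have hsum : ∑ i, ∫ ω, w i / W * f i ω * (1 - φ i ω) ∂μ =
      (∑ i, (∫ ω, f i ω * (1 - φ i ω) ∂μ) * w i) / W := by
    rw [Finset.sum_div]
    refine Finset.sum_congr rfl fun i _ => ?_
    simp_rw [mul_assoc]
    rw [integral_const_mul]
    ring
  rw [hsum] at hle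
  simp only [Finset.sum_const, Finset.card_univ, Fintype.card_finset, nsmul_eq_mul, Nat.cast_pow,
    Nat.cast_ofNat] at hle
  have h2 : (0 : ℝ) < 2 ^ Fintype.card ι := by positivity
  have h3 := le_of_mul_le_mul_left (a := (2 : ℝ) ^ Fintype.card ι) (by linarith :
    2 ^ Fintype.card ι * ((∑ i, (∫ ω, f i ω * (1 - φ i ω) ∂μ) * w i) / W) ≤
      2 ^ Fintype.card ι * (8 / 3 * ε)) h2
  rw [div_le_iff₀ hW] at h3
  linarith

open Filter Topology in
/-- Bounded sequences in a Hilbert space converge weakly along every ultrafilter. -/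
lemma exists_tendsto_inner_of_norm_le {α H : Type*} [NormedAddCommGroup H]
    [InnerProductSpace ℝ H] [CompleteSpace H] (U : Ultrafilter α) (P : α → H) (C : ℝ)
    (hP : ∀ n, ‖P n‖ ≤ C) :
    ∃ p : H, ∀ u, Tendsto (fun n => inner ℝ (P n) u) U (𝓝 (inner ℝ p u)) := by
  have hc := WeakDual.isCompact_closedBall (𝕜 := ℝ) (0 : StrongDual ℝ H) C
  let F : α → WeakDual ℝ H := fun n =>
    StrongDual.toWeakDual (InnerProductSpace.toDual ℝ H (P n))
  obtain ⟨L, -, hL⟩ := hc.ultrafilter_le_nhds (U.map F) (by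
    rw [le_principal_iff, Ultrafilter.coe_map, mem_map]
    refine univ_mem' fun n => ?_
    simpa [F] using hP n)
  refine ⟨(InnerProductSpace.toDual ℝ H).symm (WeakDual.toStrongDual L), fun u => ?_⟩
  rw [InnerProductSpace.toDual_symm_apply]
  have h : Tendsto F U (𝓝 L) := hL
  exact ((WeakDual.eval_continuous u).tendsto L).comp h

/-- Every initial segment of the sequence has a good allocation, extended by zero. -/
lemma exists_forall_allocation_lt {Ω : Type*} [MeasurableSpace Ω] (μ : Measure Ω)
    {ε : ℝ} (hε : 0 < ε) (f : ℕ → Ω → ℝ)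
    (hm : ∀ i, Measurable (f i)) (h0 : ∀ i ω, 0 ≤ f i ω) (hf : ∀ i, Integrable (f i) μ)
    (hmin : ∀ (n : ℕ) (a : Fin n → ℝ), (∀ i, 0 ≤ a i) → ∑ i, a i = 1 → ∀ A : Finset (Fin n),
      ∫ ω, min (∑ i ∈ A, a i * f i ω) (∑ i ∈ Aᶜ, a i * f i ω) ∂μ ≤ ε) (n : ℕ) :
    ∃ φ : ℕ → Ω → ℝ, (∀ i, Measurable (φ i)) ∧ (∀ i ω, 0 ≤ φ i ω) ∧ (∀ i ω, φ i ω ≤ 1) ∧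
      (∀ i j, i ≠ j → ∀ ω, φ i ω + φ j ω ≤ 1) ∧
      ∀ i ≤ n, ∫ ω, f i ω * (1 - φ i ω) ∂μ < 3 * ε := by
  obtain ⟨φ, hφ, hlt⟩ := exists_isAllocation_integral_lt μ hε (fun i : Fin (n + 1) => f i)
    (fun i => hm i) (fun i => h0 i) (fun i => hf i) (hmin (n + 1))
  refine ⟨fun i => if h : i < n + 1 then φ ⟨i, h⟩ else 0, fun i => ?_, fun i ω => ?_,
    fun i ω => ?_, fun i j hij ω => ?_, fun i hi => ?_⟩
  · dsimp only
    split_ifs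
    exacts [hφ.measurable _, measurable_const]
  · dsimp only
    split_ifs
    exacts [hφ.nonneg _ ω, le_rfl]
  · dsimp only
    split_ifs
    exacts [hφ.le_one _ ω, zero_le_one]
  · dsimp only
    split_ifs
    · exact hφ.add_le_one (by simpa using hij) ω
    · simpa using hφ.le_one _ ω
    · simpa using hφ.le_one _ ω
    · simp
  · simp only [Nat.lt_succ_of_le hi, dite_true]
    exact hlt ⟨i, Nat.lt_succ_of_le hi⟩

open Filter Topology in
/-- Nonnegative integrable functions whose convex combinations have almost disjoint parts become
disjoint after restricting each one to a set carrying all but `6 ε` of its integral. -/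
lemma exists_almost_carrier {Ω : Type*} [MeasurableSpace Ω] (μ : Measure Ω)
    {ε : ℝ} (hε : 0 < ε) (f : ℕ → Ω → ℝ)
    (hm : ∀ i, Measurable (f i)) (h0 : ∀ i ω, 0 ≤ f i ω) (hf : ∀ i, Integrable (f i) μ)
    (hmin : ∀ (n : ℕ) (a : Fin n → ℝ), (∀ i, 0 ≤ a i) → ∑ i, a i = 1 → ∀ A : Finset (Fin n),
      ∫ ω, min (∑ i ∈ A, a i * f i ω) (∑ i ∈ Aᶜ, a i * f i ω) ∂μ ≤ ε) :
    ∃ S : ℕ → Set Ω, (∀ i, MeasurableSet (S i)) ∧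
      (∀ i j, i ≠ j → ∀ᵐ ω ∂μ, ω ∈ S i → ω ∈ S j → f i ω = 0 ∨ f j ω = 0) ∧
      ∀ i, ∫ ω in (S i)ᶜ, f i ω ∂μ ≤ 6 * ε := by
  choose φ hφm hφ0 hφ1 hφ2 hφi using exists_forall_allocation_lt μ hε f hm h0 hf hmin
  let q : ℕ → Ω → ℝ := fun i ω => √(f i ω)
  have hqm : ∀ i, Measurable (q i) := fun i => (hm i).sqrt
  have hqq : ∀ i ω, q i ω * q i ω = f i ω := fun i ω => Real.mul_self_sqrt (h0 i ω)
  have hq0 : ∀ i ω, 0 ≤ q i ω := fun i ω => Real.sqrt_nonneg _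
  have hq : ∀ i, MemLp (q i) 2 μ := fun i => by
    rw [memLp_two_iff_integrable_sq (hqm i).aestronglyMeasurable]
    simpa only [sq, hqq] using hf i
  have hP : ∀ n i, MemLp (fun ω => φ n i ω * q i ω) 2 μ := fun n i =>
    (hq i).mono ((hφm n i).mul (hqm i)).aestronglyMeasurable (ae_of_all _ fun ω => by
      rw [norm_mul, Real.norm_of_nonneg (hφ0 n i ω)]
      exact mul_le_of_le_one_left (norm_nonneg _) (hφ1 n i ω))
  have hPn : ∀ i n, ‖(hP n i).toLp‖ ≤ ‖(hq i).toLp‖ := fun i n => by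
    refine Lp.norm_le_norm_of_ae_le ?_
    filter_upwards [(hP n i).coeFn_toLp, (hq i).coeFn_toLp] with ω h1 h2
    rw [h1, h2, norm_mul, Real.norm_of_nonneg (hφ0 n i ω)]
    exact mul_le_of_le_one_left (norm_nonneg _) (hφ1 n i ω)
  let U : Ultrafilter ℕ := hyperfilter ℕ
  choose p hp using fun i => exists_tendsto_inner_of_norm_le U (fun n => (hP n i).toLp) _ (hPn i)
  have hpq : ∀ i j, Integrable (fun ω => p i ω * q j ω) μ := fun i j =>
    (Lp.memLp (p i)).integrable_mul (hq j)
  have hPq : ∀ n i j, Integrable (fun ω => φ n i ω * q i ω * q j ω) μ := fun n i j =>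
    (hP n i).integrable_mul (hq j)
  have hqqi : ∀ i j, Integrable (fun ω => q i ω * q j ω) μ := fun i j =>
    (hq i).integrable_mul (hq j)
  have hlim : ∀ i j (s : Set Ω), MeasurableSet s →
      Tendsto (fun n => ∫ ω in s, φ n i ω * q i ω * q j ω ∂μ) U
        (𝓝 (∫ ω in s, p i ω * q j ω ∂μ)) := by
    intro i j s hs
    have key : ∀ (v : Lp ℝ 2 μ) (g : Ω → ℝ), v =ᵐ[μ] g →
        inner ℝ v ((hq j).indicator hs).toLp = ∫ ω in s, g ω * q j ω ∂μ := by
      intro v g hv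
      rw [L2.inner_def, ← integral_indicator hs]
      refine integral_congr_ae ?_
      filter_upwards [hv, ((hq j).indicator hs).coeFn_toLp] with ω h1 h2
      rw [h1, h2]
      by_cases hω : ω ∈ s <;> simp [hω, mul_comm]
    have := hp i ((hq j).indicator hs).toLp
    rw [key _ _ (ae_eq_refl _)] at this
    exact this.congr fun n => key _ _ (hP n i).coeFn_toLp
  have hpair : ∀ i j, i ≠ j → ∀ᵐ ω ∂μ, p i ω * q j ω + p j ω * q i ω ≤ q i ω * q j ω := by
    intro i j hij
    refine ae_le_of_forall_setIntegral_le ((hpq i j).add (hpq j i)) (hqqi i j) fun s hs _ => ?_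
    rw [integral_add (hpq i j).integrableOn (hpq j i).integrableOn]
    refine le_of_tendsto ((hlim i j s hs).add (hlim j i s hs)) (Eventually.of_forall fun n => ?_)
    rw [← integral_add (hPq n i j).integrableOn (hPq n j i).integrableOn]
    refine integral_mono ((hPq n i j).integrableOn.add (hPq n j i).integrableOn)
      (hqqi i j).integrableOn fun ω => ?_
    have := mul_le_mul_of_nonneg_right (hφ2 n i j hij ω) (mul_nonneg (hq0 i ω) (hq0 j ω))
    dsimp only
    linarith
  have hself : ∀ i, ∀ᵐ ω ∂μ, p i ω * q i ω ≤ f i ω := by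
    intro i
    refine ae_le_of_forall_setIntegral_le (hpq i i) (hf i) fun s hs _ => ?_
    refine le_of_tendsto (hlim i i s hs) (Eventually.of_forall fun n => ?_)
    refine integral_mono (hPq n i i).integrableOn (hf i).integrableOn fun ω => ?_
    dsimp only
    rw [mul_assoc, hqq]
    exact mul_le_of_le_one_left (h0 i ω) (hφ1 n i ω)
  have hint : ∀ i, ∫ ω, f i ω ∂μ - ∫ ω, p i ω * q i ω ∂μ ≤ 3 * ε := by
    intro i
    have hl := hlim i i Set.univ MeasurableSet.univ
    simp only [Measure.restrict_univ] at hl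
    refine le_of_tendsto (hl.const_sub _) ?_
    have hev : ∀ᶠ n in (U : Filter ℕ), i ≤ n :=
      Nat.hyperfilter_le_atTop (eventually_ge_atTop i)
    filter_upwards [hev] with n hn
    rw [← integral_sub (hf i) (hPq n i i)]
    refine le_trans (le_of_eq ?_) (hφi n i hn).le
    congr 1 with ω
    rw [mul_assoc, hqq]
    ring
  refine ⟨fun i => {ω | q i ω / 2 < p i ω}, fun i => measurableSet_lt ((hqm i).div_const 2)
    (Lp.stronglyMeasurable (p i)).measurable, fun i j hij => ?_, fun i => ?_⟩
  · filter_upwards [hpair i j hij] with ω hω hi hj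
    change q i ω / 2 < p i ω at hi
    change q j ω / 2 < p j ω at hj
    by_contra! hne
    have hi0 : 0 < q i ω := Real.sqrt_pos.2 ((h0 i ω).lt_of_ne' hne.1)
    have hj0 : 0 < q j ω := Real.sqrt_pos.2 ((h0 j ω).lt_of_ne' hne.2)
    nlinarith
  · have hS : MeasurableSet {ω | q i ω / 2 < p i ω} := measurableSet_lt ((hqm i).div_const 2)
      (Lp.stronglyMeasurable (p i)).measurable
    have hle : ∫ ω in {ω | q i ω / 2 < p i ω}ᶜ, f i ω ∂μ ≤
        ∫ ω, 2 * (f i ω - p i ω * q i ω) ∂μ := by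
      rw [← integral_indicator hS.compl]
      refine integral_mono_ae ((hf i).indicator hS.compl)
        (((hf i).sub (hpq i i)).const_mul 2) ?_
      filter_upwards [hself i] with ω hω
      by_cases h : q i ω / 2 < p i ω
      · rw [Set.indicator_of_notMem (by simpa using h)]
        linarith
      · rw [Set.indicator_of_mem (by simpa using h)]
        nlinarith [hqq i ω, hq0 i ω]
    rw [integral_const_mul, integral_sub (hf i) (hpq i i)] at hle
    linarith [hint i]

/-- The lattice operations of `Lp` detect disjointness pointwise. -/
lemma inf_abs_eq_zero_iff_ae {Ω : Type*} [MeasurableSpace Ω] {μ : Measure Ω} (u w : Lp ℝ 1 μ) :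
    |u| ⊓ |w| = 0 ↔ ∀ᵐ ω ∂μ, u ω = 0 ∨ w ω = 0 := by
  have hpt : ∀ a b : ℝ, |a| ⊓ |b| = 0 ↔ a = 0 ∨ b = 0 := fun a b => by
    rcases le_total |a| |b| with h | h
    · rw [inf_of_le_left h, abs_eq_zero]
      refine ⟨Or.inl, fun h' => h'.elim id fun hb => ?_⟩
      rw [hb, abs_zero] at h
      exact abs_nonpos_iff.1 h
    · rw [inf_of_le_right h, abs_eq_zero]
      refine ⟨Or.inr, fun h' => h'.elim (fun ha => ?_) id⟩
      rw [ha, abs_zero] at h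
      exact abs_nonpos_iff.1 h
  rw [Lp.eq_zero_iff_ae_eq_zero]
  constructor
  · intro h
    filter_upwards [h, Lp.coeFn_inf |u| |w|, Lp.coeFn_abs u, Lp.coeFn_abs w] with ω h1 h2 h3 h4
    rw [h2, Pi.inf_apply, h3, h4] at h1
    exact (hpt _ _).1 h1
  · intro h
    filter_upwards [h, Lp.coeFn_inf |u| |w|, Lp.coeFn_abs u, Lp.coeFn_abs w] with ω h1 h2 h3 h4
    rw [h2, Pi.inf_apply, h3, h4]
    exact (hpt _ _).2 h1

lemma inf_abs_smul_eq_zero {Ω : Type*} [MeasurableSpace Ω] {μ : Measure Ω} {u w : Lp ℝ 1 μ}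
    (h : |u| ⊓ |w| = 0) (c : ℝ) : |c • u| ⊓ |w| = 0 := by
  rw [inf_abs_eq_zero_iff_ae] at h ⊢
  filter_upwards [h, Lp.coeFn_smul c u] with ω h1 h2
  rw [h2, Pi.smul_apply, smul_eq_mul]
  exact h1.imp_left fun h => by rw [h, mul_zero]

lemma Lp_smul_nonneg {Ω : Type*} [MeasurableSpace Ω] {μ : Measure Ω} {c : ℝ} (hc : 0 ≤ c)
    {u : Lp ℝ 1 μ} (hu : 0 ≤ u) : 0 ≤ c • u := by
  rw [← Lp.coeFn_nonneg] at hu ⊢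
  filter_upwards [hu, Lp.coeFn_smul c u] with ω h1 h2
  rw [h2]
  exact mul_nonneg hc h1

lemma inf_abs_sum_eq_zero {Ω ι : Type*} [MeasurableSpace Ω] {μ : Measure Ω} {u : ι → Lp ℝ 1 μ}
    {w : Lp ℝ 1 μ} (s : Finset ι) (h : ∀ i ∈ s, |u i| ⊓ |w| = 0) : |∑ i ∈ s, u i| ⊓ |w| = 0 := by
  refine Finset.sum_induction u (fun v => |v| ⊓ |w| = 0) (fun v v' hv hv' => ?_) ?_ h
  · rw [inf_abs_eq_zero_iff_ae] at hv hv' ⊢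
    filter_upwards [hv, hv', Lp.coeFn_add v v'] with ω h1 h2 h3
    rw [h3, Pi.add_apply]
    rcases h1 with h1 | h1
    · exact h2.imp_left fun h2 => by rw [h1, h2, add_zero]
    · exact Or.inr h1
  · rw [abs_zero]
    exact inf_of_le_left (abs_nonneg w)

lemma inf_abs_eq_zero_of_hasSum {Ω ι : Type*} [MeasurableSpace Ω] {μ : Measure Ω}
    {u : ι → Lp ℝ 1 μ} {v w : Lp ℝ 1 μ} (hv : HasSum u v) (h : ∀ i, |u i| ⊓ |w| = 0) :
    |v| ⊓ |w| = 0 := by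
  have hcl : IsClosed {v : Lp ℝ 1 μ | |v| ⊓ |w| = 0} :=
    isClosed_eq ((continuous_id.sup continuous_neg).inf continuous_const) continuous_const
  exact hcl.mem_of_tendsto hv (Filter.Eventually.of_forall fun s =>
    inf_abs_sum_eq_zero s fun i _ => h i)

namespace SequenceL1

/-- The space `ℓ₁`, as `L₁` of the counting measure. -/
local notation "ℓone" => Lp ℝ 1 (Measure.count : Measure ℕ)

lemma coeFn_add_apply (x y : ℓone) (n : ℕ) : (x + y) n = x n + y n :=
  Measure.ae_count_iff.1 (Lp.coeFn_add x y) n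

lemma coeFn_smul_apply (c : ℝ) (x : ℓone) (n : ℕ) : (c • x) n = c * x n :=
  Measure.ae_count_iff.1 (Lp.coeFn_smul c x) n

lemma nonneg_iff {x : ℓone} : 0 ≤ x ↔ ∀ n, 0 ≤ x n := by
  rw [← Lp.coeFn_nonneg]
  exact Measure.ae_count_iff

lemma inf_abs_eq_zero_iff {x y : ℓone} : |x| ⊓ |y| = 0 ↔ ∀ n, x n = 0 ∨ y n = 0 :=
  (inf_abs_eq_zero_iff_ae x y).trans Measure.ae_count_iff

lemma summable_norm (x : ℓone) : Summable fun n => ‖x n‖ :=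
  integrable_count_iff.1 (L1.integrable_coeFn x)

lemma norm_eq_tsum (x : ℓone) : ‖x‖ = ∑' n, ‖x n‖ := by
  rw [L1.norm_eq_integral_norm, integral_countable (L1.integrable_coeFn x).norm]
  simp [measureReal_def]

/-- The standard unit vectors of `ℓ₁`. -/
noncomputable def unit (n : ℕ) : ℓone :=
  indicatorConstLp 1 (measurableSet_singleton n) (by simp) 1

lemma unit_apply (n m : ℕ) : unit n m = if m = n then 1 else 0 := by
  rw [unit, Measure.ae_count_iff.1 indicatorConstLp_coeFn m]
  simp [Set.indicator_apply]

lemma unit_nonneg (n : ℕ) : 0 ≤ unit n :=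
  nonneg_iff.2 fun m => by rw [unit_apply]; split_ifs <;> simp

lemma norm_unit (n : ℕ) : ‖unit n‖ = 1 := by
  rw [unit, norm_indicatorConstLp one_ne_zero ENNReal.one_ne_top]
  simp [measureReal_def]

variable {F : Type*} [NormedAddCommGroup F] [NormedSpace ℝ F]

lemma norm_smul_le_of_bound {v : ℕ → F} {C : ℝ} (hv : ∀ n, ‖v n‖ ≤ C) (x : ℓone) (n : ℕ) :
    ‖x n • v n‖ ≤ ‖x n‖ * C := by
  rw [norm_smul]
  exact mul_le_mul_of_nonneg_left (hv n) (norm_nonneg _)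

lemma summable_smul [CompleteSpace F] {v : ℕ → F} {C : ℝ} (hv : ∀ n, ‖v n‖ ≤ C) (x : ℓone) :
    Summable fun n => x n • v n :=
  ((summable_norm x).mul_right C).of_norm_bounded (norm_smul_le_of_bound hv x)

/-- The operator on `ℓ₁` that sends the unit vectors to a given bounded sequence. -/
noncomputable def synthesis [CompleteSpace F] (v : ℕ → F) (C : ℝ) (hv : ∀ n, ‖v n‖ ≤ C) :
    ℓone →L[ℝ] F :=
  LinearMap.mkContinuous
    { toFun := fun x => ∑' n, x n • v n
      map_add' := fun x y => by
        rw [← (summable_smul hv x).tsum_add (summable_smul hv y)]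
        exact tsum_congr fun n => by rw [coeFn_add_apply, add_smul]
      map_smul' := fun c x => by
        rw [RingHom.id_apply, ← (summable_smul hv x).tsum_const_smul c]
        exact tsum_congr fun n => by rw [coeFn_smul_apply, mul_smul] }
    C fun x => by
      rw [norm_eq_tsum, mul_comm]
      exact tsum_of_norm_bounded ((summable_norm x).hasSum.mul_right C)
        (norm_smul_le_of_bound hv x)

lemma hasSum_synthesis [CompleteSpace F] {v : ℕ → F} {C : ℝ} (hv : ∀ n, ‖v n‖ ≤ C) (x : ℓone) :
    HasSum (fun n => x n • v n) (synthesis v C hv x) :=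
  (summable_smul hv x).hasSum

lemma hasSum_unit (x : ℓone) : HasSum (fun n => x n • unit n) x := by
  have hs := summable_smul (fun n => (norm_unit n).le) x
  have heval : ∀ m, ∃ l : ℓone →L[ℝ] ℝ, ∀ y : ℓone, l y = y m := fun m =>
    ⟨LinearMap.mkContinuous
      { toFun := fun y : ℓone => y m
        map_add' := fun y z => coeFn_add_apply y z m
        map_smul' := fun c y => coeFn_smul_apply c y m } 1 fun y => by
      rw [one_mul, norm_eq_tsum]
      exact (summable_norm y).le_tsum m fun _ _ => norm_nonneg _, fun _ => rfl⟩
  convert hs.hasSum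
  refine Lp.ext (Measure.ae_count_iff.2 fun m => ?_)
  obtain ⟨l, hl⟩ := heval m
  rw [← hl (∑' n, x n • unit n), l.map_tsum hs, tsum_eq_single m]
  · rw [hl, coeFn_smul_apply, unit_apply, if_pos rfl, mul_one]
  · intro n hn
    rw [hl, coeFn_smul_apply, unit_apply, if_neg hn.symm, mul_zero]

lemma hasSum_map (T : ℓone →L[ℝ] F) (x : ℓone) : HasSum (fun n => x n • T (unit n)) (T x) := by
  simpa using T.hasSum (hasSum_unit x)

lemma norm_le_of_norm_map_unit_le (T : ℓone →L[ℝ] F) {C : ℝ} (h : ∀ n, ‖T (unit n)‖ ≤ C) :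
    ‖T‖ ≤ C := by
  refine T.opNorm_le_bound ((norm_nonneg _).trans (h 0)) fun x => ?_
  rw [norm_eq_tsum, mul_comm, ← (hasSum_map T x).tsum_eq]
  exact tsum_of_norm_bounded ((summable_norm x).hasSum.mul_right C) (norm_smul_le_of_bound h x)

lemma norm_sum_unit_le {n : ℕ} {a : Fin n → ℝ} (ha : ∀ i, 0 ≤ a i) (hsum : ∑ i, a i = 1)
    (A : Finset (Fin n)) : ‖∑ i ∈ A, a i • unit i‖ ≤ 1 := by
  refine (norm_sum_le _ _).trans ?_
  simp only [norm_smul, norm_unit, mul_one, Real.norm_of_nonneg (ha _)]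
  exact hsum ▸ Finset.sum_le_sum_of_subset_of_nonneg (Finset.subset_univ A) fun i _ _ => ha i

lemma inf_abs_sum_unit_compl {n : ℕ} (a : Fin n → ℝ) (A : Finset (Fin n)) :
    |∑ i ∈ A, a i • unit i| ⊓ |∑ i ∈ Aᶜ, a i • unit i| = 0 := by
  refine inf_abs_sum_eq_zero A fun i hi => ?_
  refine inf_abs_smul_eq_zero ?_ _
  rw [inf_comm]
  refine inf_abs_sum_eq_zero Aᶜ fun j hj => inf_abs_smul_eq_zero ?_ _
  rw [inf_abs_eq_zero_iff]
  intro m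
  simp only [unit_apply]
  have : (i : ℕ) ≠ j := fun h => Finset.mem_compl.1 hj (Fin.ext h ▸ hi)
  split_ifs with h1 h2 <;> simp
  omega

end SequenceL1

open SequenceL1

/-- A positive `ε`-disjointness preserving operator `T : ℓ₁ → L₁(μ)` with
`0 < ε < ‖T‖/16` admits a positive disjointness preserving `S` with `0 ≤ S ≤ T` and
`‖T - S‖ ≤ 2 √(2 ε ‖T‖ / 3)`.  Here `ℓ₁` is realized as `L₁` of counting measure on `ℕ`. -/
theorem stmt10 {Ω : Type*} [MeasurableSpace Ω] (μ : Measure Ω)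
    (ε : ℝ) (hε : 0 < ε)
    (T : Lp ℝ 1 (Measure.count : Measure ℕ) →L[ℝ] Lp ℝ 1 μ)
    (hεT : ε < ‖T‖ / 16)
    (hpos : ∀ x : Lp ℝ 1 (Measure.count : Measure ℕ), 0 ≤ x → 0 ≤ T x)
    (hDP : ∀ x y : Lp ℝ 1 (Measure.count : Measure ℕ), |x| ⊓ |y| = 0 →
      ‖|T x| ⊓ |T y|‖ ≤ ε * max ‖x‖ ‖y‖) :
    ∃ S : Lp ℝ 1 (Measure.count : Measure ℕ) →L[ℝ] Lp ℝ 1 μ,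
      (∀ x y : Lp ℝ 1 (Measure.count : Measure ℕ), |x| ⊓ |y| = 0 → |S x| ⊓ |S y| = 0) ∧
      (∀ x : Lp ℝ 1 (Measure.count : Measure ℕ), 0 ≤ x → 0 ≤ S x) ∧
      (∀ x : Lp ℝ 1 (Measure.count : Measure ℕ), 0 ≤ x → S x ≤ T x) ∧
      ‖T - S‖ ≤ 2 * Real.sqrt (2 * ε * ‖T‖ / 3) := by
  let f : ℕ → Ω → ℝ := fun n ω => |T (unit n) ω|
  have hTf : ∀ n, T (unit n) =ᵐ[μ] f n := fun n => by
    filter_upwards [(Lp.coeFn_nonneg _).2 (hpos _ (unit_nonneg n))] with ω hω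
    exact (abs_of_nonneg hω).symm
  have hfm : ∀ n, Measurable (f n) := fun n => (Lp.stronglyMeasurable _).measurable.abs
  have hf0 : ∀ n ω, 0 ≤ f n ω := fun n ω => abs_nonneg _
  have hfi : ∀ n, Integrable (f n) μ := fun n => (L1.integrable_coeFn _).abs
  obtain ⟨E, hEm, hEd, hE⟩ := exists_almost_carrier μ hε f hfm hf0 hfi fun n a ha hsum A => by
    have hT : ∀ B : Finset (Fin n), T (∑ i ∈ B, a i • unit i) =ᵐ[μ]
        fun ω => ∑ i ∈ B, a i * f i ω := fun B => by
      rw [map_sum]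
      refine (Lp.coeFn_finsetSum _ _).trans ?_
      have hB : ∀ᵐ ω ∂μ, ∀ i : Fin n, T (a i • unit i) ω = a i * f i ω := by
        rw [ae_all_iff]
        intro i
        rw [map_smul]
        filter_upwards [Lp.coeFn_smul (a i) (T (unit i)), hTf i] with ω h1 h2
        rw [h1, Pi.smul_apply, h2, smul_eq_mul]
      filter_upwards [hB] with ω hω
      rw [Finset.sum_apply]
      exact Finset.sum_congr rfl fun i _ => hω i
    have key := hDP _ _ (inf_abs_sum_unit_compl a A)
    rw [L1.norm_eq_integral_norm] at key
    refine le_trans (le_of_eq (integral_congr_ae ?_)) (key.trans (mul_le_of_le_one_right hε.le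
      (max_le (norm_sum_unit_le ha hsum A) (norm_sum_unit_le ha hsum Aᶜ))))
    filter_upwards [hT A, hT Aᶜ, Lp.coeFn_inf |T (∑ i ∈ A, a i • unit i)|
      |T (∑ i ∈ Aᶜ, a i • unit i)|, Lp.coeFn_abs (T (∑ i ∈ A, a i • unit i)),
      Lp.coeFn_abs (T (∑ i ∈ Aᶜ, a i • unit i))] with ω h1 h2 h3 h4 h5
    have hn : ∀ B : Finset (Fin n), 0 ≤ ∑ i ∈ B, a i * f i ω := fun B =>
      Finset.sum_nonneg fun i _ => mul_nonneg (ha i) (hf0 i ω)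
    rw [h3, Pi.inf_apply, h4, h5, h1, h2, abs_of_nonneg (hn A), abs_of_nonneg (hn Aᶜ),
      Real.norm_of_nonneg (le_min (hn A) (hn Aᶜ))]
  have hg : ∀ n, MemLp ((E n).indicator (f n)) 1 μ := fun n =>
    memLp_one_iff_integrable.2 ((hfi n).indicator (hEm n))
  let v : ℕ → Lp ℝ 1 μ := fun n => (hg n).toLp
  have hv0 : ∀ n, 0 ≤ v n := fun n => by
    rw [← Lp.coeFn_nonneg]
    filter_upwards [(hg n).coeFn_toLp] with ω h1
    rw [h1]
    exact Set.indicator_nonneg (fun _ _ => hf0 n _) ω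
  have hvT : ∀ n, v n ≤ T (unit n) := fun n => by
    rw [← Lp.coeFn_le]
    filter_upwards [(hg n).coeFn_toLp, hTf n] with ω h1 h2
    rw [h1, h2]
    exact Set.indicator_le_self' (fun _ _ => hf0 n _) ω
  have hvb : ∀ n, ‖v n‖ ≤ ‖T‖ := fun n =>
    (norm_le_norm_of_abs_le_abs (abs_le_abs_of_nonneg (hv0 n) (hvT n))).trans
      ((T.le_opNorm _).trans_eq (by rw [norm_unit, mul_one]))
  have hvd : ∀ i j, i ≠ j → |v i| ⊓ |v j| = 0 := fun i j hij => by
    rw [inf_abs_eq_zero_iff_ae]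
    filter_upwards [(hg i).coeFn_toLp, (hg j).coeFn_toLp, hEd i j hij] with ω h1 h2 h3
    rw [h1, h2]
    by_cases hi : ω ∈ E i <;> by_cases hj : ω ∈ E j <;> simp_all
  have hTv : ∀ n, ‖T (unit n) - v n‖ ≤ 6 * ε := fun n => by
    refine le_trans (le_of_eq ?_) (hE n)
    rw [L1.norm_eq_integral_norm, ← integral_indicator (hEm n).compl]
    refine integral_congr_ae ?_
    filter_upwards [Lp.coeFn_sub (T (unit n)) (v n), (hg n).coeFn_toLp, hTf n] with ω h1 h2 h3
    rw [h1, Pi.sub_apply, h2, h3]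
    by_cases h : ω ∈ E n <;> simp [h, abs_of_nonneg (hf0 n ω)]
  have hS := hasSum_synthesis hvb
  refine ⟨synthesis v ‖T‖ hvb, fun x y hxy => ?_, fun x hx => ?_, fun x hx => ?_, ?_⟩
  · rw [inf_abs_eq_zero_iff] at hxy
    refine inf_abs_eq_zero_of_hasSum (hS x) fun i => ?_
    rw [inf_comm]
    refine inf_abs_eq_zero_of_hasSum (hS y) fun j => ?_
    rcases eq_or_ne i j with rfl | hij
    · rcases hxy i with h | h
      · rw [h, zero_smul, abs_zero]
        exact inf_of_le_right (abs_nonneg _)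
      · rw [h, zero_smul, abs_zero]
        exact inf_of_le_left (abs_nonneg _)
    · refine inf_abs_smul_eq_zero ?_ _
      rw [inf_comm]
      exact inf_abs_smul_eq_zero (hvd i j hij) _
  · exact (hS x).nonneg fun n => Lp_smul_nonneg (nonneg_iff.1 hx n) (hv0 n)
  · refine hasSum_le (fun n => ?_) (hS x) (hasSum_map T x)
    rw [← sub_nonneg, ← smul_sub]
    exact Lp_smul_nonneg (nonneg_iff.1 hx n) (sub_nonneg.2 (hvT n))
  · have hSu : ∀ n, synthesis v ‖T‖ hvb (unit n) = v n := fun n => by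
      refine (hS (unit n)).unique ?_
      convert hasSum_single (f := fun m => unit n m • v m) n fun m hm => ?_
      · rw [unit_apply, if_pos rfl, one_smul]
      · rw [unit_apply, if_neg hm, zero_smul]
    have h6 : ‖T - synthesis v ‖T‖ hvb‖ ≤ 6 * ε := norm_le_of_norm_map_unit_le _ fun n => by
      rw [sub_apply, hSu]
      exact hTv n
    have h3 : 3 * ε ≤ √(2 * ε * ‖T‖ / 3) := Real.le_sqrt_of_sq_le (by nlinarith)
    linarith
end

section
/- For every ε > 0 there exist bounded linear operators T, M : ℓ₂ → ℓ₂ such that: M is positive and is the modulus of T (for every x ∈ ℓ₂ with x ≥ 0, M x is the least upper bound of {|Ty| : y ∈ ℓ₂, |y| ≤ x}); ‖T‖ ≥ 1; ‖M‖ ≤ 2; T is ε-disjointness preserving; ‖T − Id‖ ≤ ε; there exist disjoint positive x, y in the closed unit ball of ℓ₂ with ‖(Mx) ⊓ (My)‖ = 2^{-1/2}, so M is not c-disjointness preserving for any c < 2^{-1/2}; and ‖M − U‖ ≥ 1/(3√2) for every disjointness preserving bounded linear operator U : ℓ₂ → ℓ₂. -/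
open MeasureTheory

/-- The space `ℓ₂`, realized as `L₂` of counting measure on `ℕ`. -/
abbrev EllTwo : Type := Lp ℝ 2 (Measure.count : Measure ℕ)

namespace EllTwo

lemma ext_coord {f g : EllTwo} (h : ∀ k, f k = g k) : f = g :=
  Lp.ext (Filter.Eventually.of_forall h)

lemma le_iff_coord {f g : EllTwo} : f ≤ g ↔ ∀ k, f k ≤ g k := by
  rw [← Lp.coeFn_le, Filter.EventuallyLE, Measure.ae_count_iff]

lemma zero_coord (k : ℕ) : (0 : EllTwo) k = 0 :=
  Measure.ae_count_iff.1 (Lp.coeFn_zero ℝ 2 (Measure.count : Measure ℕ)) k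

lemma abs_coord (f : EllTwo) (k : ℕ) : |f| k = |f k| :=
  Measure.ae_count_iff.1 (Lp.coeFn_abs f) k

lemma inf_coord (f g : EllTwo) (k : ℕ) : (f ⊓ g) k = f k ⊓ g k :=
  Measure.ae_count_iff.1 (Lp.coeFn_inf f g) k

lemma add_coord (f g : EllTwo) (k : ℕ) : (f + g) k = f k + g k :=
  Measure.ae_count_iff.1 (Lp.coeFn_add f g) k

lemma sub_coord (f g : EllTwo) (k : ℕ) : (f - g) k = f k - g k :=
  Measure.ae_count_iff.1 (Lp.coeFn_sub f g) k

lemma smul_coord (c : ℝ) (f : EllTwo) (k : ℕ) : (c • f) k = c * f k :=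
  Measure.ae_count_iff.1 (Lp.coeFn_smul c f) k

lemma hasSum_sq (f : EllTwo) : HasSum (fun k => f k ^ 2) (‖f‖ ^ 2) := by
  have hint : Integrable (fun k => f k ^ 2) (Measure.count : Measure ℕ) :=
    (Lp.memLp f).integrable_sq
  have hsum : Summable (fun k => f k ^ 2) := by
    simpa using (integrable_count_iff.1 hint).norm
  have h : ‖f‖ ^ 2 = ∑' k, f k ^ 2 := by
    rw [← real_inner_self_eq_norm_sq, L2.inner_def]
    have hi : ∀ k, inner ℝ (f k) (f k) = f k ^ 2 := fun k => by
      simp [pow_two]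
    simp_rw [hi]
    rw [integral_countable hint]
    simp
  rw [h]
  exact hsum.hasSum

lemma sum_sq_le (f : EllTwo) (N : ℕ) : ∑ k ∈ Finset.range N, f k ^ 2 ≤ ‖f‖ ^ 2 :=
  sum_le_hasSum _ (fun _ _ => sq_nonneg _) f.hasSum_sq

lemma norm_sq_eq_sum {f : EllTwo} {N : ℕ} (h : ∀ k, N ≤ k → f k = 0) :
    ‖f‖ ^ 2 = ∑ k ∈ Finset.range N, f k ^ 2 :=
  f.hasSum_sq.unique <| hasSum_sum_of_ne_finset_zero fun k hk => by
    rw [h k (by simpa using hk)]; simp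

/-- The `k`-th unit vector of `ℓ₂`. -/
noncomputable def unit (k : ℕ) : EllTwo :=
  indicatorConstLp 2 (measurableSet_singleton k) (by simp) 1

lemma unit_coord (i k : ℕ) : unit i k = if k = i then 1 else 0 := by
  rw [unit, Measure.ae_count_iff.1 indicatorConstLp_coeFn k]
  simp [Set.indicator_apply]

/-- The `k`-th coordinate functional on `ℓ₂`. -/
noncomputable def coord (k : ℕ) : EllTwo →L[ℝ] ℝ := innerSL ℝ (unit k)

lemma coord_apply (k : ℕ) (f : EllTwo) : coord k f = f k := by
  have h : coord k f = ∫ x in {k}, f x ∂Measure.count := by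
    rw [coord, innerSL_apply_apply]
    exact L2.inner_indicatorConstLp_one _ _ f
  rw [h, integral_singleton]
  simp

/-- The vector of `ℓ₂` with coordinates `a k` for `k < N` and `0` beyond. -/
noncomputable def ofFinite (N : ℕ) (a : ℕ → ℝ) : EllTwo := ∑ i ∈ Finset.range N, a i • unit i

lemma ofFinite_coord (N : ℕ) (a : ℕ → ℝ) (k : ℕ) :
    ofFinite N a k = if k < N then a k else 0 := by
  rw [← coord_apply, ofFinite, map_sum]
  simp [coord_apply, unit_coord]

/-- The operator on `ℓ₂` whose matrix is the top left `N × N` corner of `A`. -/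
noncomputable def matrixOp (N : ℕ) (A : ℕ → ℕ → ℝ) : EllTwo →L[ℝ] EllTwo :=
  ∑ i ∈ Finset.range N, (∑ j ∈ Finset.range N, A i j • coord j).smulRight (unit i)

lemma matrixOp_coord (N : ℕ) (A : ℕ → ℕ → ℝ) (x : EllTwo) (k : ℕ) :
    matrixOp N A x k = if k < N then ∑ j ∈ Finset.range N, A k j * x j else 0 := by
  have h : matrixOp N A x = ofFinite N fun i => ∑ j ∈ Finset.range N, A i j * x j := by
    simp [matrixOp, ofFinite, coord_apply]
  rw [h, ofFinite_coord]

lemma matrixOp_norm_le {N : ℕ} {A : ℕ → ℕ → ℝ} {c : ℝ} (hc : 0 ≤ c)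
    (h : ∀ x : ℕ → ℝ, ∑ k ∈ Finset.range N, (∑ j ∈ Finset.range N, A k j * x j) ^ 2 ≤
      c ^ 2 * ∑ j ∈ Finset.range N, x j ^ 2) :
    ‖matrixOp N A‖ ≤ c := by
  refine ContinuousLinearMap.opNorm_le_bound _ hc fun x => ?_
  refine le_of_sq_le_sq ?_ (by positivity)
  rw [norm_sq_eq_sum (N := N) fun k hk => by rw [matrixOp_coord, if_neg hk.not_gt], mul_pow]
  calc ∑ k ∈ Finset.range N, matrixOp N A x k ^ 2
      = ∑ k ∈ Finset.range N, (∑ j ∈ Finset.range N, A k j * x j) ^ 2 :=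
        Finset.sum_congr rfl fun k hk => by rw [matrixOp_coord, if_pos (Finset.mem_range.1 hk)]
    _ ≤ c ^ 2 * ∑ j ∈ Finset.range N, x j ^ 2 := h x
    _ ≤ c ^ 2 * ‖x‖ ^ 2 := by gcongr; exact sum_sq_le x N

lemma norm_abs_inf_abs_le {U V : EllTwo →L[ℝ] EllTwo}
    (hU : ∀ x y, |x| ⊓ |y| = 0 → |U x| ⊓ |U y| = 0) {x y : EllTwo} (hxy : |x| ⊓ |y| = 0) :
    ‖|V x| ⊓ |V y|‖ ≤ 2 * ‖V - U‖ * max ‖x‖ ‖y‖ := by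
  have hle : |V x| ⊓ |V y| ≤ |(V - U) x| + |(V - U) y| := by
    rw [le_iff_coord]
    intro k
    have h0 : (|U x| ⊓ |U y|) k = 0 := by rw [hU x y hxy, zero_coord]
    rw [inf_coord, abs_coord, abs_coord] at h0
    simp only [inf_coord, add_coord, abs_coord, sub_apply, sub_coord]
    have hx := abs_sub_abs_le_abs_sub (V x k) (U x k)
    have hy := abs_sub_abs_le_abs_sub (V y k) (U y k)
    have hx' := abs_nonneg (V x k - U x k)
    have hy' := abs_nonneg (V y k - U y k)
    rcases min_choice |U x k| |U y k| with h | h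
    · exact (min_le_left _ _).trans (by linarith [h.symm.trans h0])
    · exact (min_le_right _ _).trans (by linarith [h.symm.trans h0])
  have hnonneg : 0 ≤ |V x| ⊓ |V y| := le_inf (abs_nonneg _) (abs_nonneg _)
  calc ‖|V x| ⊓ |V y|‖ ≤ ‖|(V - U) x| + |(V - U) y|‖ :=
        norm_le_norm_of_abs_le_abs (abs_le_abs_of_nonneg hnonneg hle)
    _ ≤ ‖(V - U) x‖ + ‖(V - U) y‖ := by
        simpa only [norm_abs_eq_norm] using norm_add_le |(V - U) x| |(V - U) y|
    _ ≤ ‖V - U‖ * max ‖x‖ ‖y‖ + ‖V - U‖ * max ‖x‖ ‖y‖ := by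
        gcongr
        · exact (ContinuousLinearMap.le_opNorm _ _).trans (by gcongr; exact le_max_left _ _)
        · exact (ContinuousLinearMap.le_opNorm _ _).trans (by gcongr; exact le_max_right _ _)
    _ = 2 * ‖V - U‖ * max ‖x‖ ‖y‖ := by ring

/-- The entries of the matrix of `id + matrixOp N A` in its top left corner. -/
noncomputable def addIdEntry (A : ℕ → ℕ → ℝ) (k j : ℕ) : ℝ := (if k = j then 1 else 0) + A k j

lemma id_add_matrixOp_coord (N : ℕ) (A : ℕ → ℕ → ℝ) (x : EllTwo) (k : ℕ) :
    (ContinuousLinearMap.id ℝ EllTwo + matrixOp N A) x k =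
      if k < N then ∑ j ∈ Finset.range N, addIdEntry A k j * x j else x k := by
  rw [add_apply, add_coord, matrixOp_coord]
  split_ifs with hk
  · simp [addIdEntry, add_mul, Finset.sum_add_distrib, hk]
  · simp

/-- The correction `B` for which `id + matrixOp N B` is the modulus of `id + matrixOp N A`. -/
noncomputable def absCorrection (A : ℕ → ℕ → ℝ) (k j : ℕ) : ℝ :=
  |addIdEntry A k j| - if k = j then 1 else 0

lemma addIdEntry_absCorrection (A : ℕ → ℕ → ℝ) (k j : ℕ) :
    addIdEntry (absCorrection A) k j = |addIdEntry A k j| := by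
  simp [addIdEntry, absCorrection]

lemma abs_absCorrection_le (A : ℕ → ℕ → ℝ) (k j : ℕ) : |absCorrection A k j| ≤ |A k j| := by
  have h := abs_abs_sub_abs_le (addIdEntry A k j) (if k = j then 1 else 0)
  unfold absCorrection
  unfold addIdEntry at h ⊢
  split_ifs at h ⊢
  · simpa using h
  · simp

lemma modulus_coord (N : ℕ) (A : ℕ → ℕ → ℝ) (x : EllTwo) (k : ℕ) :
    (ContinuousLinearMap.id ℝ EllTwo + matrixOp N (absCorrection A)) x k =
      if k < N then ∑ j ∈ Finset.range N, |addIdEntry A k j| * x j else x k := by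
  simp_rw [id_add_matrixOp_coord, addIdEntry_absCorrection]

lemma isLUB_modulus (N : ℕ) (A : ℕ → ℕ → ℝ) {x : EllTwo} (hx : 0 ≤ x) :
    IsLUB {z : EllTwo | ∃ y : EllTwo, |y| ≤ x ∧
        z = |(ContinuousLinearMap.id ℝ EllTwo + matrixOp N A) y|}
      ((ContinuousLinearMap.id ℝ EllTwo + matrixOp N (absCorrection A)) x) := by
  have hx0 : ∀ k, 0 ≤ x k := fun k => by simpa [zero_coord] using le_iff_coord.1 hx k
  constructor
  · rintro _ ⟨y, hy, rfl⟩
    have hy' : ∀ k, |y k| ≤ x k := fun k => by simpa [abs_coord] using le_iff_coord.1 hy k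
    refine le_iff_coord.2 fun k => ?_
    rw [abs_coord, id_add_matrixOp_coord, modulus_coord]
    split_ifs
    · refine (Finset.abs_sum_le_sum_abs _ _).trans (Finset.sum_le_sum fun j _ => ?_)
      rw [abs_mul]
      exact mul_le_mul_of_nonneg_left (hy' j) (abs_nonneg _)
    · exact hy' k
  · intro z hz
    refine le_iff_coord.2 fun k => ?_
    rw [modulus_coord]
    split_ifs with hk
    · have hy : |ofFinite N fun j => SignType.sign (addIdEntry A k j) * x j| ≤ x := by
        refine le_iff_coord.2 fun i => ?_
        rw [abs_coord, ofFinite_coord]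
        split_ifs
        · rw [abs_mul, abs_of_nonneg (hx0 i)]
          refine mul_le_of_le_one_left (hx0 i) ?_
          rcases SignType.sign (addIdEntry A k i) <;> simp
        · simpa using hx0 i
      refine le_trans ?_ (le_iff_coord.1 (hz ⟨_, hy, rfl⟩) k)
      rw [abs_coord, id_add_matrixOp_coord, if_pos hk]
      refine le_trans (le_of_eq (Finset.sum_congr rfl fun j hj => ?_)) (le_abs_self _)
      rw [ofFinite_coord, if_pos (Finset.mem_range.1 hj), ← mul_assoc, self_mul_sign]
    · have h := le_iff_coord.1 (hz ⟨x, (abs_of_nonneg hx).le, rfl⟩) k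
      rw [abs_coord, id_add_matrixOp_coord, if_neg hk] at h
      exact (le_abs_self _).trans h

lemma matrixOp_norm_le_one {N : ℕ} {A : ℕ → ℕ → ℝ} (h : ∀ k j, |A k j| ≤ 1 / N) :
    ‖matrixOp N A‖ ≤ 1 := by
  rcases N.eq_zero_or_pos with rfl | hN
  · simp [matrixOp]
  have hN' : (0 : ℝ) < N := by exact_mod_cast hN
  refine matrixOp_norm_le zero_le_one fun x => ?_
  have hrow : ∀ k ∈ Finset.range N, (∑ j ∈ Finset.range N, A k j * x j) ^ 2 ≤
      1 / N * ∑ j ∈ Finset.range N, x j ^ 2 := fun k _ => by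
    have h1 : ∑ j ∈ Finset.range N, A k j ^ 2 ≤ 1 / N := by
      calc ∑ j ∈ Finset.range N, A k j ^ 2 ≤ ∑ _j ∈ Finset.range N, (1 / N : ℝ) ^ 2 :=
            Finset.sum_le_sum fun j _ => sq_le_sq' (abs_le.1 (h k j)).1 (abs_le.1 (h k j)).2
        _ = 1 / N := by rw [Finset.sum_const, Finset.card_range, nsmul_eq_mul]; field_simp
    exact (Finset.sum_mul_sq_le_sq_mul_sq _ _ _).trans
      (mul_le_mul_of_nonneg_right h1 (Finset.sum_nonneg fun _ _ => sq_nonneg _))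
  refine (Finset.sum_le_sum hrow).trans (le_of_eq ?_)
  rw [Finset.sum_const, Finset.card_range, nsmul_eq_mul]
  field_simp

lemma one_le_norm_id_add_matrixOp (N : ℕ) (A : ℕ → ℕ → ℝ) :
    1 ≤ ‖ContinuousLinearMap.id ℝ EllTwo + matrixOp N A‖ := by
  have hfix : (ContinuousLinearMap.id ℝ EllTwo + matrixOp N A) (unit N) = unit N := by
    refine ext_coord fun k => ?_
    rw [id_add_matrixOp_coord]
    split_ifs with hk
    · rw [unit_coord, if_neg hk.ne]
      refine Finset.sum_eq_zero fun j hj => ?_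
      rw [unit_coord, if_neg (Finset.mem_range.1 hj).ne, mul_zero]
    · rfl
  have hpos : 0 < ‖unit N‖ := by
    refine norm_pos_iff.2 fun h => ?_
    have h1 := unit_coord N N
    rw [h, zero_coord] at h1
    simp at h1
  have h := (ContinuousLinearMap.id ℝ EllTwo + matrixOp N A).le_opNorm (unit N)
  rw [hfix] at h
  exact le_of_mul_le_mul_right (by simpa using h) hpos

/-- Sylvester's Hadamard matrices, described through their quadratic form. -/
lemma exists_hadamard (n : ℕ) : ∃ σ : ℕ → ℕ → ℝ, (∀ k j, |σ k j| = 1) ∧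
    ∀ x : ℕ → ℝ, ∑ k ∈ Finset.range (2 ^ n), (∑ j ∈ Finset.range (2 ^ n), σ k j * x j) ^ 2 =
      2 ^ n * ∑ j ∈ Finset.range (2 ^ n), x j ^ 2 := by
  induction n with
  | zero =>
    refine ⟨fun _ _ => 1, by simp, by simp⟩
  | succ n ih =>
    obtain ⟨σ, hσ, hquad⟩ := ih
    generalize hN : 2 ^ n = N at hquad
    let τ : ℕ → ℕ → ℝ := fun k j => if k < N then (if j < N then σ k j else σ k (j - N))
      else (if j < N then σ (k - N) j else -σ (k - N) (j - N))
    refine ⟨τ, fun k j => ?_, fun x => ?_⟩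
    · dsimp only [τ]
      split_ifs <;> simp [hσ]
    · have htop : ∀ k ∈ Finset.range N, ∑ j ∈ Finset.range (N + N), τ k j * x j =
          ∑ j ∈ Finset.range N, σ k j * x j + ∑ j ∈ Finset.range N, σ k j * x (N + j) :=
        fun k hk => by
          rw [Finset.sum_range_add]
          congr 1 <;> refine Finset.sum_congr rfl fun j hj => ?_ <;>
            simp [τ, Finset.mem_range.1 hk, Finset.mem_range.1 hj]
      have hbot : ∀ k, ∑ j ∈ Finset.range (N + N), τ (N + k) j * x j =
          ∑ j ∈ Finset.range N, σ k j * x j - ∑ j ∈ Finset.range N, σ k j * x (N + j) :=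
        fun k => by
          rw [Finset.sum_range_add, sub_eq_add_neg, ← Finset.sum_neg_distrib]
          congr 1 <;> refine Finset.sum_congr rfl fun j hj => ?_ <;>
            simp [τ, Finset.mem_range.1 hj]
      rw [pow_succ 2 n, mul_two, hN, Finset.sum_range_add _ N N, Finset.sum_range_add _ N N,
        pow_succ, mul_assoc, mul_left_comm, mul_add, mul_add, ← hquad x,
        ← hquad fun j => x (N + j), ← Finset.sum_add_distrib, ← mul_add,
        ← Finset.sum_add_distrib, Finset.mul_sum]
      refine Finset.sum_congr rfl fun k hk => ?_
      rw [htop k hk, hbot]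
      ring

lemma exists_inf_modulus_norm_eq {m : ℕ} (hm : 0 < m) {A : ℕ → ℕ → ℝ}
    (hA : ∀ k j, |A k j| = 1 / (2 * m)) :
    ∃ x y : EllTwo, 0 ≤ x ∧ 0 ≤ y ∧ ‖x‖ ≤ 1 ∧ ‖y‖ ≤ 1 ∧ x ⊓ y = 0 ∧
      ‖(ContinuousLinearMap.id ℝ EllTwo + matrixOp (m + m) (absCorrection A)) x ⊓
        (ContinuousLinearMap.id ℝ EllTwo + matrixOp (m + m) (absCorrection A)) y‖ =
          (Real.sqrt 2)⁻¹ := by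
  have hm1 : (1 : ℝ) ≤ m := by exact_mod_cast hm
  have hm0 : (0 : ℝ) < m := by linarith
  obtain ⟨c, hc0, hc⟩ : ∃ c : ℝ, 0 ≤ c ∧ m * c ^ 2 = 1 :=
    ⟨(Real.sqrt m)⁻¹, by positivity, by rw [inv_pow, Real.sq_sqrt hm0.le]; field_simp⟩
  have hoff : ∀ k j, k ≠ j → |addIdEntry A k j| = 1 / (2 * m) := fun k j hkj => by
    simp [addIdEntry, hkj, hA]
  have hge : ∀ k j, 1 / (2 * m) ≤ |addIdEntry A k j| := fun k j => by
    rcases eq_or_ne k j with rfl | hkj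
    · have hle : 1 / (2 * m : ℝ) ≤ 1 / 2 := by
        rw [div_le_div_iff₀ (by positivity) (by positivity)]; linarith
      have h := neg_abs_le (A k k)
      refine le_trans ?_ (le_abs_self _)
      rw [hA] at h
      simp only [addIdEntry, if_true]
      linarith
    · exact (hoff k j hkj).ge
  have hhalf : ∑ _j ∈ Finset.range m, 1 / (2 * m : ℝ) = 1 / 2 := by
    rw [Finset.sum_const, Finset.card_range, nsmul_eq_mul]; field_simp
  have hsum_ge : ∀ k s, 1 / 2 ≤ ∑ j ∈ Finset.range m, |addIdEntry A k (s + j)| := fun k s =>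
    hhalf.symm.le.trans (Finset.sum_le_sum fun j _ => hge k _)
  have hsum_eq : ∀ k s, (∀ j < m, k ≠ s + j) →
      ∑ j ∈ Finset.range m, |addIdEntry A k (s + j)| = 1 / 2 := fun k s hks =>
    (Finset.sum_congr rfl fun j hj => hoff k _ (hks j (Finset.mem_range.1 hj))).trans hhalf
  let block : ℕ → EllTwo := fun s => ofFinite (m + m) fun j => if s ≤ j ∧ j < s + m then c else 0
  have hblock : ∀ s k, s ≤ m → block s k = if s ≤ k ∧ k < s + m then c else 0 := fun s k hs => by
    simp only [block, ofFinite_coord]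
    split_ifs <;> first | rfl | omega
  have hblock_sum : ∀ s ≤ m, ∀ f : ℕ → ℝ → ℝ, (∀ j, f j 0 = 0) →
      ∑ j ∈ Finset.range (m + m), f j (block s j) = ∑ j ∈ Finset.range m, f (s + j) c :=
    fun s hs f hf => by
      have h : ∀ j, f j (block s j) = if j ∈ Finset.Ico s (s + m) then f j c else 0 := fun j => by
        simp only [hblock s j hs, Finset.mem_Ico]
        split_ifs <;> simp [hf]
      simp_rw [h]
      rw [← Finset.sum_filter, Finset.filter_mem_eq_inter, Finset.inter_eq_right.2,
        Finset.sum_Ico_eq_sum_range, Nat.add_sub_cancel_left]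
      intro j hj
      simp only [Finset.mem_Ico, Finset.mem_range] at hj ⊢
      omega
  have hnonneg : ∀ s ≤ m, 0 ≤ block s := fun s hs => le_iff_coord.2 fun k => by
    rw [zero_coord, hblock s k hs]
    split_ifs
    exacts [hc0, le_rfl]
  have hnorm : ∀ s ≤ m, ‖block s‖ ≤ 1 := fun s hs => by
    have hsq : ‖block s‖ ^ 2 = 1 := by
      rw [norm_sq_eq_sum (N := m + m), hblock_sum s hs (fun _ t => t ^ 2) (by simp)]
      · simpa using hc
      · intro k hk
        rw [hblock s k hs, if_neg (by omega)]
    exact (sq_le_one_iff₀ (norm_nonneg _)).1 hsq.le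
  refine ⟨block 0, block m, hnonneg _ m.zero_le, hnonneg _ le_rfl, hnorm _ m.zero_le,
    hnorm _ le_rfl, ext_coord fun k => ?_, ?_⟩
  · rw [inf_coord, hblock _ _ m.zero_le, hblock _ _ le_rfl, zero_coord]
    split_ifs <;> first | omega | simp [hc0]
  · have hval : ∀ k, ((ContinuousLinearMap.id ℝ EllTwo + matrixOp (m + m) (absCorrection A))
        (block 0) ⊓ (ContinuousLinearMap.id ℝ EllTwo + matrixOp (m + m) (absCorrection A))
        (block m)) k = if k < m + m then c / 2 else 0 := fun k => by
      rw [inf_coord, modulus_coord, modulus_coord]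
      split_ifs with hk
      · rw [hblock_sum 0 m.zero_le (fun j t => |addIdEntry A k j| * t) (by simp),
          hblock_sum m le_rfl (fun j t => |addIdEntry A k j| * t) (by simp),
          ← Finset.sum_mul, ← Finset.sum_mul, div_eq_mul_one_div, mul_comm c]
        rcases lt_or_ge k m with hkm | hkm
        · rw [hsum_eq k m (fun j _ => by omega)]
          exact inf_eq_right.2 (mul_le_mul_of_nonneg_right (hsum_ge k 0) hc0)
        · rw [hsum_eq k 0 (fun j _ => by omega)]
          exact inf_eq_left.2 (mul_le_mul_of_nonneg_right (hsum_ge k m) hc0)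
      · rw [hblock _ _ m.zero_le, hblock _ _ le_rfl, if_neg (by omega), if_neg (by omega)]
        simp
    rw [← Real.sqrt_inv, eq_comm, Real.sqrt_eq_iff_eq_sq (by norm_num) (norm_nonneg _),
      norm_sq_eq_sum (N := m + m) fun k hk => by rw [hval, if_neg hk.not_gt]]
    rw [Finset.sum_congr rfl fun k hk => by rw [hval, if_pos (Finset.mem_range.1 hk)]]
    rw [Finset.sum_const, Finset.card_range, nsmul_eq_mul]
    push_cast
    linear_combination (-1 / 2 : ℝ) * hc

end EllTwo

/-- For every `ε > 0` there is an operator `T` on `ℓ₂` (realized as `L₂` of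
counting measure on `ℕ`) with modulus `M = |T|`, such that `‖T‖ ≥ 1`, `‖M‖ ≤ 2`, `T` is
`ε`-disjointness preserving, `‖T - Id‖ ≤ ε`, yet `M` fails to be `c`-disjointness preserving
for `c < 2^{-1/2}` (witnessed by disjoint positive unit-ball vectors `x, y` with
`‖Mx ⊓ My‖ = 2^{-1/2}`), and `‖M - U‖ ≥ 1/(3√2)` for every disjointness preserving `U`. -/
theorem stmt16 (ε : ℝ) (hε : 0 < ε) :
    ∃ T M : Lp ℝ 2 (Measure.count : Measure ℕ) →L[ℝ] Lp ℝ 2 (Measure.count : Measure ℕ),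
      (∀ x, 0 ≤ x → 0 ≤ M x) ∧
      (∀ x : Lp ℝ 2 (Measure.count : Measure ℕ), 0 ≤ x →
        IsLUB {z : Lp ℝ 2 (Measure.count : Measure ℕ) |
          ∃ y : Lp ℝ 2 (Measure.count : Measure ℕ), |y| ≤ x ∧ z = |T y|} (M x)) ∧
      1 ≤ ‖T‖ ∧
      ‖M‖ ≤ 2 ∧
      (∀ x y, |x| ⊓ |y| = 0 → ‖|T x| ⊓ |T y|‖ ≤ ε * max ‖x‖ ‖y‖) ∧
      ‖T - ContinuousLinearMap.id ℝ (Lp ℝ 2 (Measure.count : Measure ℕ))‖ ≤ ε ∧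
      (∃ x y : Lp ℝ 2 (Measure.count : Measure ℕ),
        0 ≤ x ∧ 0 ≤ y ∧ ‖x‖ ≤ 1 ∧ ‖y‖ ≤ 1 ∧ x ⊓ y = 0 ∧
        ‖M x ⊓ M y‖ = (Real.sqrt 2)⁻¹) ∧
      (∀ U : Lp ℝ 2 (Measure.count : Measure ℕ) →L[ℝ] Lp ℝ 2 (Measure.count : Measure ℕ),
        (∀ x y, |x| ⊓ |y| = 0 → |U x| ⊓ |U y| = 0) →
        1 / (3 * Real.sqrt 2) ≤ ‖M - U‖) := by
  obtain ⟨n, hn⟩ := exists_pow_lt_of_lt_one (show 0 < (ε / 2) ^ 2 by positivity)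
    (show (1 / 2 : ℝ) < 1 by norm_num)
  obtain ⟨σ, hσ, hquad⟩ := EllTwo.exists_hadamard (n + 1)
  have hpow : (2 : ℕ) ^ (n + 1) = 2 ^ n + 2 ^ n := by ring
  rw [hpow] at hquad
  obtain ⟨m, hm⟩ : ∃ m : ℕ, m = 2 ^ n := ⟨_, rfl⟩
  have hmR : (2 : ℝ) ^ n = m := by rw [hm]; push_cast; rfl
  rw [← hm, pow_succ, hmR] at hquad
  have hm0 : 0 < m := hm ▸ by positivity
  have hm0' : (0 : ℝ) < m := by exact_mod_cast hm0
  have hmε : 1 / (m : ℝ) < (ε / 2) ^ 2 := by rwa [one_div_pow, hmR] at hn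
  set A : ℕ → ℕ → ℝ := fun k j => 1 / (2 * m) * σ k j with hAdef
  have hA : ∀ k j, |A k j| = 1 / (2 * m) := fun k j => by
    rw [hAdef, abs_mul, hσ, mul_one, abs_of_pos (by positivity)]
  have hS : ‖EllTwo.matrixOp (m + m) A‖ ≤ ε / 2 := by
    refine EllTwo.matrixOp_norm_le (by positivity) fun x => ?_
    have hscale : ∀ k, (∑ j ∈ Finset.range (m + m), A k j * x j) ^ 2 =
        (1 / (2 * m)) ^ 2 * (∑ j ∈ Finset.range (m + m), σ k j * x j) ^ 2 := fun k => by
      rw [← mul_pow, Finset.mul_sum]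
      simp only [hAdef, mul_assoc]
    rw [Finset.sum_congr rfl fun k _ => hscale k, ← Finset.mul_sum, hquad, ← mul_assoc]
    refine mul_le_mul_of_nonneg_right (le_trans ?_ hmε.le) (Finset.sum_nonneg fun _ _ => sq_nonneg _)
    rw [div_pow, div_mul_eq_mul_div, div_le_div_iff₀ (by positivity) hm0']
    nlinarith [sq_nonneg (m : ℝ)]
  set T := ContinuousLinearMap.id ℝ EllTwo + EllTwo.matrixOp (m + m) A with hT
  set M := ContinuousLinearMap.id ℝ EllTwo +
    EllTwo.matrixOp (m + m) (EllTwo.absCorrection A) with hM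
  have hTid : T - ContinuousLinearMap.id ℝ EllTwo = EllTwo.matrixOp (m + m) A := by
    rw [hT, add_sub_cancel_left]
  have hLUB : ∀ x : EllTwo, 0 ≤ x →
      IsLUB {z : EllTwo | ∃ y : EllTwo, |y| ≤ x ∧ z = |T y|} (M x) :=
    fun x hx => EllTwo.isLUB_modulus (m + m) A hx
  have hwit := EllTwo.exists_inf_modulus_norm_eq hm0 hA
  refine ⟨T, M, fun x hx => ?_, hLUB, EllTwo.one_le_norm_id_add_matrixOp _ _, ?_,
    fun x y hxy => ?_, ?_, hwit, fun U hU => ?_⟩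
  · exact (abs_nonneg (T x)).trans ((hLUB x hx).1 ⟨x, (abs_of_nonneg hx).le, rfl⟩)
  · have hB : ‖EllTwo.matrixOp (m + m) (EllTwo.absCorrection A)‖ ≤ 1 :=
      EllTwo.matrixOp_norm_le_one fun k j => by
        refine (EllTwo.abs_absCorrection_le A k j).trans ((hA k j).trans_le ?_)
        push_cast
        rw [two_mul]
    linarith [norm_add_le (ContinuousLinearMap.id ℝ EllTwo)
      (EllTwo.matrixOp (m + m) (EllTwo.absCorrection A)),
      ContinuousLinearMap.norm_id_le (𝕜 := ℝ) (E := EllTwo)]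
  · refine (EllTwo.norm_abs_inf_abs_le (U := ContinuousLinearMap.id ℝ EllTwo)
      (fun _ _ h => h) hxy).trans ?_
    rw [hTid]
    gcongr
    linarith
  · rw [hTid]
    linarith
  · obtain ⟨x, y, hx, hy, hx1, hy1, hxy, hnorm⟩ := hwit
    have hpos : ∀ z : EllTwo, 0 ≤ z → |M z| = M z := fun z hz =>
      abs_of_nonneg ((abs_nonneg (T z)).trans ((hLUB z hz).1 ⟨z, (abs_of_nonneg hz).le, rfl⟩))
    have h := EllTwo.norm_abs_inf_abs_le (V := M) hU
      (show |x| ⊓ |y| = 0 by rwa [abs_of_nonneg hx, abs_of_nonneg hy])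
    rw [hpos x hx, hpos y hy, hnorm] at h
    have h2 : (Real.sqrt 2)⁻¹ ≤ 2 * ‖M - U‖ := h.trans <|
      mul_le_of_le_one_right (by positivity) (max_le hx1 hy1)
    have h3 : 0 < (Real.sqrt 2)⁻¹ := by positivity
    rw [one_div, mul_inv]
    linarith
end
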